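/- Let (η_t)_{t≥1} be any positive non-decreasing sequence of learning rates. For every horizon T ≥ 1 and every sequence of request patterns (x_t)_{t=1}^T, the expected number of cache-configuration switches of the FTPL coded caching policy with learning rates (η_t) satisfies C(T) = E_γ[ ∑_{t=1}^{T−1} 1{ s_{t+1}(γ) ≠ s_t(γ) } ] ≤ (2·r_max·(|S|−1) / √(2π)) · ∑_{t=1}^T 1/η_t. -/

import Mathlib

open MeasureTheory ProbabilityTheory

noncomputable section

namespace CodedCaching

/-- The finite set of feasible cache configurations: binary vectors (entries in `{0,1}`)
with at least `M` ones. -/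
def configs (N M : ℕ) : Finset (Fin N → ℕ) :=
  (Fintype.piFinset fun _ : Fin N => Finset.range 2).filter fun s => M ≤ ∑ i, s i

/-- The finite set of request patterns: `ℕ`-valued vectors whose entries sum to `K`. -/
def requests (N K : ℕ) : Finset (Fin N → ℕ) :=
  (Fintype.piFinset fun _ : Fin N => Finset.range (K + 1)).filter fun x => ∑ i, x i = K

/-- The truncated request vector `y = min(x, 1_N)`, viewed as a real vector. -/
def trunc {N : ℕ} (x : Fin N → ℕ) : Fin N → ℝ := fun i => (min (x i) 1 : ℕ)

/-- The coded part of the expected transmission rate: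
`(⟨s,1⟩/M − 1)·(1 − (1 − M/⟨s,1⟩)^⟨x,s⟩)`. -/
def codedRate {N : ℕ} (M : ℕ) (s x : Fin N → ℕ) : ℝ :=
  ((∑ i, (s i : ℝ)) / M - 1) *
    (1 - (1 - (M : ℝ) / ∑ i, (s i : ℝ)) ^ (∑ i, x i * s i))

/-- The expected transmission rate `K(s,x) = ⟨1_N − s, y⟩ + codedRate`. -/
def rate {N : ℕ} (M : ℕ) (s x : Fin N → ℕ) : ℝ :=
  (∑ i, (1 - (s i : ℝ)) * trunc x i) + codedRate M s x

/-- The common component value of the vector `f(x,s)`: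
`(1/M)·(1 − (1 − M/⟨s,1⟩)^⟨x,s⟩)`. -/
def fcomp {N : ℕ} (M : ℕ) (x s : Fin N → ℕ) : ℝ :=
  (1 / M) * (1 - (1 - (M : ℝ) / ∑ i, (s i : ℝ)) ^ (∑ i, x i * s i))

/-- `r_max`: the maximum of the rate over feasible configurations and request patterns. -/
def rmax (N K M : ℕ) : ℝ :=
  sSup {r : ℝ | ∃ s ∈ configs N M, ∃ x ∈ requests N K, r = rate M s x}

/-- `r_max^C`: the maximum of the coded rate over feasible configurations and requests. -/
def rmaxC (N K M : ℕ) : ℝ :=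
  sSup {r : ℝ | ∃ s ∈ configs N M, ∃ x ∈ requests N K, r = codedRate M s x}

/-- The standard Gaussian measure `N(0, I_N)` on `ℝ^N`. -/
def gauss (N : ℕ) : Measure (Fin N → ℝ) :=
  Measure.pi fun _ => gaussianReal 0 1

/-- The Gaussian width constant `G_max = E_γ[max_{s ∈ S} ⟨s, γ⟩]`. -/
def gmax (N M : ℕ) : ℝ :=
  ∫ γ, sSup {r : ℝ | ∃ s ∈ configs N M, r = ∑ i, (s i : ℝ) * γ i} ∂gauss N

/-- The FTPL objective at time `t` with learning rate `η` and perturbation `γ`: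
`⟨ s − (M/N)·1_N , ∑_{i=1}^{t−1} f(x_i, s) − Y_t + η·γ ⟩` where `Y_t = ∑_{i=1}^{t−1} y_i`. -/
def obj {N : ℕ} (M : ℕ) (x : ℕ → Fin N → ℕ) (η : ℝ) (t : ℕ)
    (γ : Fin N → ℝ) (s : Fin N → ℕ) : ℝ :=
  ∑ j, ((s j : ℝ) - (M : ℝ) / N) *
    ((∑ i ∈ Finset.Ico 1 t, fcomp M (x i) s)
      - (∑ i ∈ Finset.Ico 1 t, trunc (x i) j) + η * γ j)

/-- The FTPL policy: a measurable selection `σ t γ` of a minimizer of the perturbed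
cumulative cost over the feasible configurations, for learning-rate schedule `η`. -/
def IsFTPL {N : ℕ} (M : ℕ) (η : ℕ → ℝ) (x : ℕ → Fin N → ℕ)
    (σ : ℕ → (Fin N → ℝ) → Fin N → ℕ) : Prop :=
  (∀ t, Measurable (σ t)) ∧ (∀ t γ, σ t γ ∈ configs N M) ∧
    ∀ t γ, ∀ s ∈ configs N M, obj M x (η t) t γ (σ t γ) ≤ obj M x (η t) t γ s

/-- The regret of a (randomly perturbed) policy `σ` on the request sequence `x`
over horizon `T`, with respect to the best static configuration in hindsight. -/
def regret {N : ℕ} (M : ℕ) (x : ℕ → Fin N → ℕ)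
    (σ : ℕ → (Fin N → ℝ) → Fin N → ℕ) (T : ℕ) : ℝ :=
  (∑ t ∈ Finset.Icc 1 T, ∫ γ, rate M (σ t γ) (x t) ∂gauss N)
    - sInf {r : ℝ | ∃ s ∈ configs N M, r = ∑ t ∈ Finset.Icc 1 T, rate M s (x t)}

/-- The expected number of cache-configuration switches of the policy `σ` up to time `T`. -/
def switchCount {N : ℕ} (σ : ℕ → (Fin N → ℝ) → Fin N → ℕ) (T : ℕ) : ℝ :=
  ∫ γ, (∑ t ∈ Finset.Icc 1 (T - 1), if σ (t + 1) γ = σ t γ then (0 : ℝ) else 1) ∂gauss N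

instance isProbabilityMeasure_gauss (N : ℕ) : IsProbabilityMeasure (gauss N) := by
  unfold gauss; infer_instance

lemma le_one_of_mem_configs {N M : ℕ} {s : Fin N → ℕ} (hs : s ∈ configs N M) (j : Fin N) :
    s j ≤ 1 := by
  simp only [configs, Finset.mem_filter, Fintype.mem_piFinset, Finset.mem_range] at hs
  have := hs.1 j
  omega

lemma le_sum_of_mem_configs {N M : ℕ} {s : Fin N → ℕ} (hs : s ∈ configs N M) :
    (M : ℝ) ≤ ∑ i, (s i : ℝ) := by
  simp only [configs, Finset.mem_filter] at hs
  exact_mod_cast hs.2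

lemma mem_configs_of_le {N M : ℕ} {s : Fin N → ℕ} (h1 : ∀ j, s j ≤ 1) (h2 : M ≤ ∑ i, s i) :
    s ∈ configs N M := by
  simp only [configs, Finset.mem_filter, Fintype.mem_piFinset, Finset.mem_range]
  exact ⟨fun j => Nat.lt_succ_of_le (h1 j), h2⟩

lemma rate_nonneg {N M : ℕ} {s : Fin N → ℕ} (hM : 0 < M) (hs : s ∈ configs N M)
    (x : Fin N → ℕ) : 0 ≤ rate M s x := by
  have hMs := le_sum_of_mem_configs hs
  have hM' : (0 : ℝ) < M := by exact_mod_cast hM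
  have hdiv : (M : ℝ) / ∑ i, (s i : ℝ) ≤ 1 := (div_le_one (hM'.trans_le hMs)).2 hMs
  have hdiv0 : 0 ≤ (M : ℝ) / ∑ i, (s i : ℝ) := by positivity
  refine add_nonneg (Finset.sum_nonneg fun i _ => mul_nonneg ?_ ?_) (mul_nonneg ?_ ?_)
  · have : (s i : ℝ) ≤ 1 := by exact_mod_cast le_one_of_mem_configs hs i
    linarith
  · exact Nat.cast_nonneg _
  · have := (one_le_div hM').2 hMs
    linarith
  · have := pow_le_one₀ (n := ∑ i, x i * s i) (sub_nonneg.2 hdiv) (by linarith)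
    linarith

lemma rate_le_rmax {N K M : ℕ} {s x : Fin N → ℕ} (hs : s ∈ configs N M)
    (hx : x ∈ requests N K) : rate M s x ≤ rmax N K M := by
  refine le_csSup (Set.Finite.bddAbove ?_) ⟨s, hs, x, hx, rfl⟩
  refine ((configs N M ×ˢ requests N K).image fun p => rate M p.1 p.2).finite_toSet.subset ?_
  rintro r ⟨s, hs, x, hx, rfl⟩
  exact Finset.mem_coe.2 (Finset.mem_image.2 ⟨(s, x), Finset.mem_product.2 ⟨hs, hx⟩, rfl⟩)

lemma succ_le_card_configs {N M : ℕ} (hMN : M < N) : N + 1 ≤ (configs N M).card := by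
  have hinj : Function.Injective fun j : Fin N => Function.update (1 : Fin N → ℕ) j 0 := by
    intro i j hij
    by_contra hne
    have := congrFun hij i
    simp [Function.update_of_ne hne] at this
  have hnot : (1 : Fin N → ℕ) ∉
      Finset.univ.image fun j : Fin N => Function.update (1 : Fin N → ℕ) j 0 := by
    intro h
    obtain ⟨j, -, hj⟩ := Finset.mem_image.1 h
    simpa using congrFun hj j
  calc N + 1 = (insert (1 : Fin N → ℕ)
        (Finset.univ.image fun j : Fin N => Function.update (1 : Fin N → ℕ) j 0)).card := by
        rw [Finset.card_insert_of_notMem hnot, Finset.card_image_of_injective _ hinj]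
        simp
    _ ≤ (configs N M).card := Finset.card_le_card ?_
  intro s hs
  rcases Finset.mem_insert.1 hs with rfl | hs
  · exact mem_configs_of_le (fun j => le_rfl) (by simpa using hMN.le)
  · obtain ⟨j, -, rfl⟩ := Finset.mem_image.1 hs
    refine mem_configs_of_le (fun i => ?_) ?_
    · by_cases h : i = j
      · subst h; simp
      · simp [Function.update_of_ne h]
    · rw [Finset.sum_update_of_mem (Finset.mem_univ j)]
      simp [Finset.card_sdiff]
      omega

lemma configs_eq_one {N : ℕ} {s : Fin N → ℕ} (hs : s ∈ configs N N) : s = 1 := by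
  have hle : ∀ i ∈ Finset.univ, s i ≤ (1 : Fin N → ℕ) i := fun i _ => le_one_of_mem_configs hs i
  have hsum : ∑ i, s i = ∑ i, (1 : Fin N → ℕ) i := by
    refine le_antisymm (Finset.sum_le_sum hle) ?_
    simpa using (Finset.mem_filter.1 hs).2
  exact funext fun i => (Finset.sum_eq_sum_iff_of_le hle).1 hsum i (Finset.mem_univ i)

/-- Up to a term that does not depend on the configuration, the FTPL objective is the cumulative
rate perturbed by `η ⟨s, γ⟩`. -/
lemma obj_eq {N M : ℕ} (hN : 0 < N) (hM : 0 < M) (x : ℕ → Fin N → ℕ) (η : ℝ) (t : ℕ)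
    (γ : Fin N → ℝ) (s : Fin N → ℕ) :
    obj M x η t γ s = (∑ i ∈ Finset.Ico 1 t, rate M s (x i)) + η * ∑ j, (s j : ℝ) * γ j
      - ((∑ i ∈ Finset.Ico 1 t, ∑ j, (1 - (M : ℝ) / N) * trunc (x i) j)
        + η * ∑ j, (M : ℝ) / N * γ j) := by
  have hN' : (N : ℝ) ≠ 0 := by positivity
  have hM' : (M : ℝ) ≠ 0 := by positivity
  have key : ∀ i, ∑ j, ((s j : ℝ) - (M : ℝ) / N) * (fcomp M (x i) s - trunc (x i) j)
      = rate M s (x i) - ∑ j, (1 - (M : ℝ) / N) * trunc (x i) j := by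
    intro i
    have h1 : ∑ j, ((s j : ℝ) - (M : ℝ) / N) * fcomp M (x i) s = codedRate M s (x i) := by
      rw [← Finset.sum_mul, Finset.sum_sub_distrib]
      simp only [Finset.sum_const, Finset.card_univ, Fintype.card_fin, nsmul_eq_mul, fcomp,
        codedRate]
      field_simp
    simp only [mul_sub, Finset.sum_sub_distrib, h1, rate]
    have h2 : ∑ j, ((s j : ℝ) - (M : ℝ) / N) * trunc (x i) j
        = ∑ j, (1 - (M : ℝ) / N) * trunc (x i) j - ∑ j, (1 - (s j : ℝ)) * trunc (x i) j := by
      rw [← Finset.sum_sub_distrib]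
      exact Finset.sum_congr rfl fun j _ => by ring
    rw [h2]; ring
  calc obj M x η t γ s
      = (∑ i ∈ Finset.Ico 1 t,
          ∑ j, ((s j : ℝ) - (M : ℝ) / N) * (fcomp M (x i) s - trunc (x i) j))
        + η * ∑ j, ((s j : ℝ) - (M : ℝ) / N) * γ j := by
        rw [Finset.sum_comm, Finset.mul_sum, ← Finset.sum_add_distrib]
        refine Finset.sum_congr rfl fun j _ => ?_
        rw [← Finset.mul_sum, Finset.sum_sub_distrib]
        ring
    _ = _ := by
        rw [Finset.sum_congr rfl fun i _ => key i, Finset.sum_sub_distrib]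
        simp only [sub_mul ((s _ : ℕ) : ℝ), Finset.sum_sub_distrib]
        ring

/-- An FTPL choice minimizes the cumulative rate scaled by `1 / η` and perturbed by `⟨s, γ⟩`. -/
lemma IsFTPL.perturbed_le {N M : ℕ} (hN : 0 < N) (hM : 0 < M) {η : ℕ → ℝ}
    {x : ℕ → Fin N → ℕ} {σ : ℕ → (Fin N → ℝ) → Fin N → ℕ} (hσ : IsFTPL M η x σ) {t : ℕ}
    (hη : 0 < η t) (γ : Fin N → ℝ) {s : Fin N → ℕ} (hs : s ∈ configs N M) :
    (∑ i ∈ Finset.Ico 1 t, rate M (σ t γ) (x i)) / η t + ∑ j, (σ t γ j : ℝ) * γ j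
      ≤ (∑ i ∈ Finset.Ico 1 t, rate M s (x i)) / η t + ∑ j, (s j : ℝ) * γ j := by
  have h := hσ.2.2 t γ s hs
  rw [obj_eq hN hM, obj_eq hN hM] at h
  rw [div_add' _ _ _ hη.ne', div_add' _ _ _ hη.ne']
  gcongr ?_ / _
  linarith

/-- The standard Gaussian density is at most `1 / √(2π)`, so a set has Gaussian measure at most its
diameter divided by `√(2π)`. -/
lemma gaussianReal_le_of_forall_sub_le {s : Set ℝ} {D : ℝ}
    (hs : ∀ u ∈ s, ∀ v ∈ s, v - u ≤ D) :
    gaussianReal 0 1 s ≤ ENNReal.ofReal (D / √(2 * Real.pi)) := by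
  rw [gaussianReal_apply 0 one_ne_zero]
  have hpdf : ∀ y, gaussianPDF 0 1 y ≤ ENNReal.ofReal (1 / √(2 * Real.pi)) := by
    intro y
    refine ENNReal.ofReal_le_ofReal ?_
    simp only [gaussianPDFReal, NNReal.coe_one, mul_one, sub_zero, one_div]
    refine mul_le_of_le_one_right (by positivity) (Real.exp_le_one_iff.2 ?_)
    have := sq_nonneg y
    linarith
  have hvol : volume s ≤ ENNReal.ofReal D := by
    refine (Real.volume_le_diam s).trans (Metric.ediam_le fun u hu v hv => ?_)
    rw [edist_dist]
    exact ENNReal.ofReal_le_ofReal (abs_sub_le_iff.2 ⟨hs v hv u hu, hs u hu v hv⟩)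
  calc ∫⁻ y in s, gaussianPDF 0 1 y ≤ ∫⁻ _ in s, ENNReal.ofReal (1 / √(2 * Real.pi)) :=
        lintegral_mono hpdf
    _ = ENNReal.ofReal (1 / √(2 * Real.pi)) * volume s := by simp
    _ ≤ ENNReal.ofReal (1 / √(2 * Real.pi)) * ENNReal.ofReal D := by gcongr
    _ = _ := by
        rw [← ENNReal.ofReal_mul (by positivity)]
        congr 1; ring

/-- A measurable set whose sections along one coordinate have product-marginal measure at most `c`
has product measure at most `c`. -/
lemma measure_pi_le_of_section_le {ι : Type*} [Fintype ι] [DecidableEq ι] {X : ι → Type*}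
    [∀ i, MeasurableSpace (X i)] (μ : ∀ i, Measure (X i)) [∀ i, IsProbabilityMeasure (μ i)]
    {E : Set (∀ i, X i)} (hE : MeasurableSet E) (j : ι) {c : ENNReal}
    (h : ∀ γ, μ j {u | Function.update γ j u ∈ E} ≤ c) : Measure.pi μ E ≤ c := by
  rcases isEmpty_or_nonempty (∀ i, X i) with hX | ⟨⟨γ₀⟩⟩
  · simp [Set.eq_empty_of_isEmpty E]
  have hf : Measurable (E.indicator (1 : (∀ i, X i) → ENNReal)) := measurable_one.indicator hE
  have hsec : ∀ γ, (∫⁻ u, E.indicator (1 : (∀ i, X i) → ENNReal) (Function.update γ j u) ∂μ j)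
      ≤ c := by
    intro γ
    have : (fun u => E.indicator (1 : (∀ i, X i) → ENNReal) (Function.update γ j u))
        = {u | Function.update γ j u ∈ E}.indicator 1 := by
      ext u; simp [Set.indicator]
    rw [this]
    exact (lintegral_indicator_one (measurable_update γ hE)).trans_le (h γ)
  rw [← lintegral_indicator_one hE, lintegral_eq_lmarginal_univ γ₀,
    lmarginal_erase' _ hf (Finset.mem_univ j)]
  refine (lmarginal_mono (g := fun _ => c) hsec γ₀).trans ?_
  simp [lmarginal]

/-- Two selections of minimizers of perturbed costs `a` and `b`, whose difference `b - a` has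
oscillation at most `D`, disagree in a given coordinate with small Gaussian probability. -/
lemma gauss_ne_coord_le {N : ℕ} {S : Set (Fin N → ℕ)} (hS : ∀ s ∈ S, ∀ j, s j ≤ 1)
    {a b : (Fin N → ℕ) → ℝ} {D : ℝ}
    (hD : ∀ s ∈ S, ∀ s' ∈ S, (b s - a s) - (b s' - a s') ≤ D)
    {p q : (Fin N → ℝ) → Fin N → ℕ} (hpm : Measurable p) (hqm : Measurable q)
    (hpS : ∀ γ, p γ ∈ S) (hqS : ∀ γ, q γ ∈ S)
    (hp : ∀ γ, ∀ s ∈ S, a (p γ) + ∑ i, (p γ i : ℝ) * γ i ≤ a s + ∑ i, (s i : ℝ) * γ i)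
    (hq : ∀ γ, ∀ s ∈ S, b (q γ) + ∑ i, (q γ i : ℝ) * γ i ≤ b s + ∑ i, (s i : ℝ) * γ i)
    (j : Fin N) :
    gauss N {γ | q γ j ≠ p γ j} ≤ ENNReal.ofReal (D / √(2 * Real.pi)) := by
  have hE : MeasurableSet {γ : Fin N → ℝ | q γ j ≠ p γ j} :=
    (measurableSet_eq_fun ((measurable_pi_apply j).comp hqm)
      ((measurable_pi_apply j).comp hpm)).compl
  refine measure_pi_le_of_section_le _ hE j fun γ => gaussianReal_le_of_forall_sub_le ?_
  intro u hu v hv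
  simp only [Set.mem_ofPred_eq] at hu hv
  have hlin : ∀ (s : Fin N → ℕ) (w : ℝ), ∑ i, (s i : ℝ) * Function.update γ j w i
      = (s j : ℝ) * w + ∑ i ∈ Finset.univ.erase j, (s i : ℝ) * γ i := by
    intro s w
    rw [← Finset.add_sum_erase _ _ (Finset.mem_univ j), Function.update_self]
    congr 1
    refine Finset.sum_congr rfl fun i hi => ?_
    rw [Function.update_of_ne (Finset.ne_of_mem_erase hi)]
  set pu := p (Function.update γ j u) with hpu
  set pv := p (Function.update γ j v) with hpv
  set qu := q (Function.update γ j u) with hqu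
  set qv := q (Function.update γ j v) with hqv
  have spu : pu ∈ S := hpS _
  have spv : pv ∈ S := hpS _
  have squ : qu ∈ S := hqS _
  have sqv : qv ∈ S := hqS _
  have h1 := hp (Function.update γ j u) pv spv
  have h2 := hp (Function.update γ j v) pu spu
  have h3 := hq (Function.update γ j u) qv sqv
  have h4 := hq (Function.update γ j v) qu squ
  have h5 := hp (Function.update γ j v) qu squ
  have h6 := hq (Function.update γ j u) pv spv
  have h7 := hq (Function.update γ j v) pu spu
  have h8 := hp (Function.update γ j u) qv sqv
  have d0 := hD pu spu pu spu
  have d1 := hD pv spv qu squ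
  have d2 := hD pu spu qv sqv
  simp only [hlin, ← hpu, ← hpv, ← hqu, ← hqv] at h1 h2 h3 h4 h5 h6 h7 h8
  have b1 := hS pu spu j
  have b2 := hS pv spv j
  have b3 := hS qu squ j
  have b4 := hS qv sqv j
  by_contra! hlt
  interval_cases pu j <;> interval_cases pv j <;> interval_cases qu j <;> interval_cases qv j <;>
    first
    | exact hu rfl
    | exact hv rfl
    | (push_cast at *; linarith)

/-- Two selections of minimizers of perturbed costs `a` and `b`, whose difference `b - a` has
oscillation at most `D`, disagree with small Gaussian probability. -/
lemma gauss_ne_le {N : ℕ} {S : Set (Fin N → ℕ)} (hS : ∀ s ∈ S, ∀ j, s j ≤ 1)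
    {a b : (Fin N → ℕ) → ℝ} {D : ℝ} (hD0 : 0 ≤ D)
    (hD : ∀ s ∈ S, ∀ s' ∈ S, (b s - a s) - (b s' - a s') ≤ D)
    {p q : (Fin N → ℝ) → Fin N → ℕ} (hpm : Measurable p) (hqm : Measurable q)
    (hpS : ∀ γ, p γ ∈ S) (hqS : ∀ γ, q γ ∈ S)
    (hp : ∀ γ, ∀ s ∈ S, a (p γ) + ∑ i, (p γ i : ℝ) * γ i ≤ a s + ∑ i, (s i : ℝ) * γ i)
    (hq : ∀ γ, ∀ s ∈ S, b (q γ) + ∑ i, (q γ i : ℝ) * γ i ≤ b s + ∑ i, (s i : ℝ) * γ i) :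
    (gauss N).real {γ | q γ ≠ p γ} ≤ N * (D / √(2 * Real.pi)) := by
  have hsub : {γ | q γ ≠ p γ} = ⋃ j, {γ | q γ j ≠ p γ j} := by
    ext γ
    simp [Function.ne_iff]
  rw [hsub]
  refine (measureReal_iUnion_fintype_le _).trans ?_
  calc ∑ j, (gauss N).real {γ | q γ j ≠ p γ j} ≤ ∑ _j : Fin N, D / √(2 * Real.pi) :=
        Finset.sum_le_sum fun j _ => ENNReal.toReal_le_of_le_ofReal (by positivity)
          (gauss_ne_coord_le hS hD hpm hqm hpS hqS hp hq j)
    _ = N * (D / √(2 * Real.pi)) := by simp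

lemma switchCount_eq {N : ℕ} {σ : ℕ → (Fin N → ℝ) → Fin N → ℕ} (hσ : ∀ t, Measurable (σ t))
    (T : ℕ) :
    switchCount σ T = ∑ t ∈ Finset.Icc 1 (T - 1), (gauss N).real {γ | σ (t + 1) γ ≠ σ t γ} := by
  have hE : ∀ t, MeasurableSet {γ | σ (t + 1) γ ≠ σ t γ} := fun t =>
    (measurableSet_eq_fun (hσ (t + 1)) (hσ t)).compl
  have hind : ∀ t, (fun γ => if σ (t + 1) γ = σ t γ then (0 : ℝ) else 1)
      = {γ | σ (t + 1) γ ≠ σ t γ}.indicator 1 := by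
    intro t
    ext γ
    by_cases h : σ (t + 1) γ = σ t γ <;> simp [h]
  unfold switchCount
  rw [integral_finsetSum]
  · refine Finset.sum_congr rfl fun t _ => ?_
    rw [hind, integral_indicator_one (hE t)]
  · intro t _
    rw [hind]
    exact (integrable_const (1 : ℝ)).indicator (hE t)

/-- Summation by parts for the oscillations of the scaled cumulative costs. -/
lemma sum_oscillation_eq (r : ℝ) (w : ℕ → ℝ) (n : ℕ) :
    ∑ t ∈ Finset.Icc 1 n, (r * w (t + 1) + ((t : ℝ) - 1) * r * (w t - w (t + 1)))
      = 2 * r * ∑ t ∈ Finset.Icc 1 (n + 1), w t - 2 * r * w 1 - r * n * w (n + 1) := by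
  induction n with
  | zero => simp
  | succ n ih =>
    rw [Finset.sum_Icc_succ_top (by omega), ih, Finset.sum_Icc_succ_top (b := n + 1) (by omega)]
    push_cast
    ring

lemma IsFTPL.gauss_switch_le {N K M : ℕ} (hN : 0 < N) (hM : 0 < M) {η : ℕ → ℝ}
    {x : ℕ → Fin N → ℕ} (hx : ∀ t, x t ∈ requests N K)
    {σ : ℕ → (Fin N → ℝ) → Fin N → ℕ} (hσ : IsFTPL M η x σ) {t : ℕ} (ht : 1 ≤ t)
    (hη : 0 < η t) (hmono : η t ≤ η (t + 1)) (hr : 0 ≤ rmax N K M) :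
    (gauss N).real {γ | σ (t + 1) γ ≠ σ t γ} ≤
      N * ((rmax N K M * (1 / η (t + 1))
        + ((t : ℝ) - 1) * rmax N K M * (1 / η t - 1 / η (t + 1))) / √(2 * Real.pi)) := by
  have hη' : 0 < η (t + 1) := hη.trans_le hmono
  have hw : 0 ≤ 1 / η t - 1 / η (t + 1) := sub_nonneg.2 (one_div_le_one_div_of_le hη hmono)
  have ht' : (0 : ℝ) ≤ (t : ℝ) - 1 := sub_nonneg.2 (by exact_mod_cast ht)
  refine gauss_ne_le (S := (configs N M : Set (Fin N → ℕ)))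
    (a := fun s => (∑ i ∈ Finset.Ico 1 t, rate M s (x i)) / η t)
    (b := fun s => (∑ i ∈ Finset.Ico 1 (t + 1), rate M s (x i)) / η (t + 1))
    (fun s hs => le_one_of_mem_configs (Finset.mem_coe.1 hs)) ?_ ?_ (hσ.1 t) (hσ.1 (t + 1))
    (hσ.2.1 t) (hσ.2.1 (t + 1)) (fun γ s hs => hσ.perturbed_le hN hM hη γ hs)
    (fun γ s hs => hσ.perturbed_le hN hM hη' γ hs)
  · positivity
  · have hΔ : ∀ s, (∑ i ∈ Finset.Ico 1 (t + 1), rate M s (x i)) / η (t + 1)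
        - (∑ i ∈ Finset.Ico 1 t, rate M s (x i)) / η t
        = rate M s (x t) * (1 / η (t + 1))
          - (∑ i ∈ Finset.Ico 1 t, rate M s (x i)) * (1 / η t - 1 / η (t + 1)) := by
      intro s
      rw [Finset.sum_Ico_succ_top ht]
      ring
    intro s hs s' hs'
    have hs := Finset.mem_coe.1 hs
    have hs' := Finset.mem_coe.1 hs'
    simp only [hΔ]
    have e1 : rate M s (x t) * (1 / η (t + 1)) ≤ rmax N K M * (1 / η (t + 1)) := by
      gcongr
      exact rate_le_rmax hs (hx t)
    have e2 : 0 ≤ rate M s' (x t) * (1 / η (t + 1)) :=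
      mul_nonneg (rate_nonneg hM hs' _) (by positivity)
    have e3 : 0 ≤ (∑ i ∈ Finset.Ico 1 t, rate M s (x i)) * (1 / η t - 1 / η (t + 1)) :=
      mul_nonneg (Finset.sum_nonneg fun i _ => rate_nonneg hM hs _) hw
    have e4 : (∑ i ∈ Finset.Ico 1 t, rate M s' (x i)) * (1 / η t - 1 / η (t + 1))
        ≤ ((t : ℝ) - 1) * rmax N K M * (1 / η t - 1 / η (t + 1)) := by
      gcongr
      calc ∑ i ∈ Finset.Ico 1 t, rate M s' (x i) ≤ ∑ _i ∈ Finset.Ico 1 t, rmax N K M :=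
            Finset.sum_le_sum fun i _ => rate_le_rmax hs' (hx i)
        _ = ((t : ℝ) - 1) * rmax N K M := by
            rw [Finset.sum_const, Nat.card_Ico, nsmul_eq_mul, Nat.cast_sub ht, Nat.cast_one]
    linarith

/-- Switching-cost corollary for a general positive non-decreasing learning-rate
schedule `(η_t)_{t≥1}`: the expected number of switches up to horizon `T` satisfies
`C(T) ≤ (2·r_max·(|S|−1)/√(2π))·∑_{t=1}^T 1/η_t`. -/
theorem ftpl_switch_count_general_eta (N K M : ℕ)
    (hN : 0 < N) (hK : 0 < K) (hM : 0 < M) (hMN : M ≤ N)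
    (η : ℕ → ℝ) (hηpos : ∀ t, 1 ≤ t → 0 < η t)
    (hηmono : ∀ t, 1 ≤ t → η t ≤ η (t + 1))
    (x : ℕ → Fin N → ℕ) (hx : ∀ t, x t ∈ requests N K)
    (σ : ℕ → (Fin N → ℝ) → Fin N → ℕ) (hσ : IsFTPL M η x σ)
    (T : ℕ) (hT : 1 ≤ T) :
    switchCount σ T ≤
      2 * rmax N K M * (((configs N M).card : ℝ) - 1) / Real.sqrt (2 * Real.pi)
        * (∑ t ∈ Finset.Icc 1 T, 1 / η t) := by
  obtain ⟨n, rfl⟩ : ∃ n, T = n + 1 := ⟨T - 1, by omega⟩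
  have hr : 0 ≤ rmax N K M :=
    (rate_nonneg hM (hσ.2.1 0 0) (x 0)).trans (rate_le_rmax (hσ.2.1 0 0) (hx 0))
  have hsum : 0 ≤ ∑ t ∈ Finset.Icc 1 (n + 1), 1 / η t :=
    Finset.sum_nonneg fun t ht => (one_div_pos.2 (hηpos t (Finset.mem_Icc.1 ht).1)).le
  rw [switchCount_eq hσ.1, Nat.add_sub_cancel]
  rcases hMN.eq_or_lt with rfl | hlt
  · have hone : ∀ t γ, σ t γ = 1 := fun t γ => configs_eq_one (hσ.2.1 t γ)
    have hcard : (1 : ℝ) ≤ (configs M M).card := by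
      exact_mod_cast Finset.card_pos.2 ⟨_, hσ.2.1 0 0⟩
    have hcard' : 0 ≤ ((configs M M).card : ℝ) - 1 := sub_nonneg.2 hcard
    simp only [hone, ne_eq, not_true_eq_false, Set.ofPred_false, measureReal_empty,
      Finset.sum_const_zero]
    positivity
  · have hcard : (N : ℝ) ≤ ((configs N M).card : ℝ) - 1 := by
      have : ((N + 1 : ℕ) : ℝ) ≤ (configs N M).card := by
        exact_mod_cast succ_le_card_configs hlt
      push_cast at this
      linarith
    have h1 := one_div_pos.2 (hηpos 1 le_rfl)
    have hn := one_div_pos.2 (hηpos (n + 1) (by omega))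
    calc ∑ t ∈ Finset.Icc 1 n, (gauss N).real {γ | σ (t + 1) γ ≠ σ t γ}
        ≤ ∑ t ∈ Finset.Icc 1 n, N * ((rmax N K M * (1 / η (t + 1))
            + ((t : ℝ) - 1) * rmax N K M * (1 / η t - 1 / η (t + 1))) / √(2 * Real.pi)) :=
          Finset.sum_le_sum fun t ht =>
            have ht := (Finset.mem_Icc.1 ht).1
            hσ.gauss_switch_le hN hM hx ht (hηpos t ht) (hηmono t ht) hr
      _ = N * ((2 * rmax N K M * ∑ t ∈ Finset.Icc 1 (n + 1), 1 / η t
            - 2 * rmax N K M * (1 / η 1) - rmax N K M * n * (1 / η (n + 1)))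
              / √(2 * Real.pi)) := by
          rw [← Finset.mul_sum, ← Finset.sum_div,
            sum_oscillation_eq (rmax N K M) (fun t => 1 / η t) n]
      _ ≤ N * ((2 * rmax N K M * ∑ t ∈ Finset.Icc 1 (n + 1), 1 / η t) / √(2 * Real.pi)) := by
          gcongr
          have p1 : 0 ≤ 2 * rmax N K M * (1 / η 1) := by positivity
          have p2 : 0 ≤ rmax N K M * n * (1 / η (n + 1)) := by positivity
          linarith
      _ ≤ (((configs N M).card : ℝ) - 1)
            * ((2 * rmax N K M * ∑ t ∈ Finset.Icc 1 (n + 1), 1 / η t) / √(2 * Real.pi)) := by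
          gcongr
      _ = _ := by ring

end CodedCaching
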